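/- arXiv:2105.02722 — 9 statements merged into one kernel-verified Lean document; each statement's English description precedes it below -/
import Mathlib

section
/- Let H be a convex subgraph of a finite simple graph G, with vertex set V_H, and let P be a mutual-visibility set of G. Then P ∩ V_H is a mutual-visibility set of H. -/
open SimpleGraph

attribute [local instance] Classical.propDecidable

/-- Two vertices `u`, `v` of a set of points `P` are mutually visible in `G` if there is a
shortest `u,v`-path (a walk whose length equals the distance `G.dist u v`) none of whose
internal vertices lies in `P`. -/
def SimpleGraph.MutuallyVisible {V : Type*} (G : SimpleGraph V) (P : Set V) (u v : V) : Prop :=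
  ∃ p : G.Walk u v, p.length = G.dist u v ∧ ∀ w ∈ p.support.tail.dropLast, w ∉ P

/-- `P` is a mutual-visibility set of `G` if every two distinct points of `P`
are mutually visible. -/
def SimpleGraph.IsMVSet {V : Type*} (G : SimpleGraph V) (P : Set V) : Prop :=
  ∀ u ∈ P, ∀ v ∈ P, u ≠ v → G.MutuallyVisible P u v

/-- The mutual-visibility number `μ(G)`: the maximum cardinality of a
mutual-visibility set of `G`. -/
noncomputable def SimpleGraph.mutualVisibilityNumber {V : Type*} [Fintype V]
    (G : SimpleGraph V) : ℕ :=
  sSup {n | ∃ P : Set V, G.IsMVSet P ∧ P.ncard = n}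

/-- A vertex set `S` is convex in `G` if every shortest path in `G` between two vertices of `S`
has all of its vertices in `S`. -/
def SimpleGraph.IsConvexSet {V : Type*} (G : SimpleGraph V) (S : Set V) : Prop :=
  ∀ u ∈ S, ∀ v ∈ S, ∀ p : G.Walk u v, p.length = G.dist u v → ∀ w ∈ p.support, w ∈ S

/-- The convex hull of a set `A` of vertices: the smallest convex set containing `A`. -/
def SimpleGraph.convexHullSet {V : Type*} (G : SimpleGraph V) (A : Set V) : Set V :=
  ⋂₀ {S : Set V | G.IsConvexSet S ∧ A ⊆ S}

/-- `x` is an articulation vertex of `G` if deleting `x` increases the number of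
connected components. -/
def SimpleGraph.IsArticulation {V : Type*} (G : SimpleGraph V) (x : V) : Prop :=
  Nat.card G.ConnectedComponent < Nat.card (G.induce {x}ᶜ).ConnectedComponent

/-- `G` is a block graph if every 2-connected induced subgraph (an induced subgraph on at
least 3 vertices that is connected and remains connected after deleting any one vertex)
is complete. -/
def SimpleGraph.IsBlockGraph {V : Type*} (G : SimpleGraph V) : Prop :=
  ∀ S : Set V, 3 ≤ S.ncard → (G.induce S).Connected →
    (∀ x ∈ S, (G.induce (S \ {x})).Connected) →
    ∀ u ∈ S, ∀ v ∈ S, u ≠ v → G.Adj u v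

/-- The join of two graphs: their disjoint union together with all edges between the
two vertex sets. -/
def SimpleGraph.joinGraph {V₁ V₂ : Type*} (G₁ : SimpleGraph V₁) (G₂ : SimpleGraph V₂) :
    SimpleGraph (V₁ ⊕ V₂) :=
  (G₁ ⊕g G₂) ⊔ completeBipartiteGraph V₁ V₂

theorem mvSet_inter_convex_subgraph {V : Type*} [Fintype V] (G : SimpleGraph V)
    (S : Set V) (hS : G.IsConvexSet S) (P : Set V) (hP : G.IsMVSet P) :
    (G.induce S).IsMVSet {x : S | (x : V) ∈ P} := by
  rintro ⟨u, hu⟩ huP ⟨v, hv⟩ hvP huv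
  obtain ⟨p, hp, hpP⟩ := hP u huP v hvP fun h ↦ huv (Subtype.ext h)
  have hpS := hS u hu v hv p hp
  obtain ⟨q, hlen, hsupp⟩ : ∃ q : (G.induce S).Walk ⟨u, hu⟩ ⟨v, hv⟩,
      q.length = p.length ∧ q.support.map Subtype.val = p.support := by
    have hq := p.map_induce hpS
    exact ⟨p.induce S hpS, (Walk.length_map _ _).symm.trans (congrArg Walk.length hq),
      (Walk.support_map _ _).symm.trans (congrArg Walk.support hq)⟩
  refine ⟨q, le_antisymm ?_ (dist_le q), fun w hw hwP ↦ hpP w ?_ hwP⟩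
  · obtain ⟨r, hr⟩ := q.reachable.exists_walk_length_eq_dist
    rw [hlen, hp, ← hr, ← Walk.length_map (Embedding.induce S).toHom r]
    exact dist_le _
  · rw [← hsupp, ← List.map_tail, ← List.map_dropLast]
    exact List.mem_map_of_mem hw
end

section
/- Let H be a convex subgraph of a finite simple graph G. Then μ(H) ≤ μ(G). -/
open SimpleGraph

attribute [local instance] Classical.propDecidable

/-- Distances between vertices reachable inside a convex set agree with those of the ambient
graph. -/
theorem SimpleGraph.IsConvexSet.dist_induce {V : Type*} {G : SimpleGraph V} {S : Set V}
    (hS : G.IsConvexSet S) {u v : S} (h : (G.induce S).Reachable u v) :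
    (G.induce S).dist u v = G.dist u v := by
  apply le_antisymm
  · have hG : G.Reachable u v := h.map (Embedding.induce S).toHom
    obtain ⟨q, hq⟩ := hG.exists_walk_length_eq_dist
    have hqS := hS u u.2 v v.2 q hq
    calc (G.induce S).dist u v ≤ (q.induce S hqS).length := dist_le _
      _ = q.length := (Walk.length_map (Embedding.induce S).toHom _).symm.trans
          (congrArg Walk.length (Walk.map_induce q hqS))
      _ = G.dist u v := hq
  · obtain ⟨p, hp⟩ := h.exists_walk_length_eq_dist
    rw [← hp, ← Walk.length_map (Embedding.induce S).toHom]
    exact dist_le _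

/-- A mutual-visibility set of a convex subgraph is a mutual-visibility set of the ambient
graph. -/
theorem SimpleGraph.IsConvexSet.isMVSet_image {V : Type*} {G : SimpleGraph V} {S : Set V}
    (hS : G.IsConvexSet S) {P : Set S} (hP : (G.induce S).IsMVSet P) :
    G.IsMVSet (Subtype.val '' P) := by
  rintro _ ⟨u, hu, rfl⟩ _ ⟨v, hv, rfl⟩ huv
  obtain ⟨p, hp, hvis⟩ := hP u hu v hv (fun h => huv (congrArg _ h))
  refine ⟨p.map (Embedding.induce S).toHom, ?_, ?_⟩
  · exact (Walk.length_map _ p).trans (hp.trans (hS.dist_induce p.reachable))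
  · intro w hw
    have hsupp : (p.map (Embedding.induce S).toHom).support.tail.dropLast =
        p.support.tail.dropLast.map (Embedding.induce (G := G) S).toHom := by
      rw [Walk.support_map, ← List.map_tail, ← List.map_dropLast]
    obtain ⟨x, hx, rfl⟩ := List.mem_map.mp (hsupp ▸ hw)
    rintro ⟨y, hy, hyx⟩
    exact hvis x hx (Subtype.val_injective hyx ▸ hy)

theorem SimpleGraph.IsMVSet.ncard_le_mutualVisibilityNumber {V : Type*} [Fintype V]
    {G : SimpleGraph V} {P : Set V} (hP : G.IsMVSet P) :
    P.ncard ≤ G.mutualVisibilityNumber := by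
  refine le_csSup ⟨Nat.card V, ?_⟩ ⟨P, hP, rfl⟩
  rintro _ ⟨Q, -, rfl⟩
  exact Set.ncard_le_card Q

theorem mu_convex_subgraph_le {V : Type*} [Fintype V] (G : SimpleGraph V)
    (S : Set V) (hS : G.IsConvexSet S) :
    (G.induce S).mutualVisibilityNumber ≤ G.mutualVisibilityNumber := by
  refine csSup_le ⟨0, ∅, by simp [IsMVSet], Set.ncard_empty _⟩ ?_
  rintro _ ⟨P, hP, rfl⟩
  rw [← Set.ncard_image_of_injective P Subtype.val_injective]
  exact (hS.isMVSet_image hP).ncard_le_mutualVisibilityNumber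
end

section
/- Let G=(V,E) be a finite simple graph and let V_1, V_2, …, V_k be subsets of V with V_1 ∪ V_2 ∪ ⋯ ∪ V_k = V. Then μ(G) ≤ Σ_{i=1}^{k} μ(G[conv(V_i)]), where conv(V_i) denotes the convex hull of V_i in G. -/
open SimpleGraph

attribute [local instance] Classical.propDecidable

namespace SimpleGraph

variable {V : Type*} {G : SimpleGraph V}

theorem isConvexSet_convexHullSet (G : SimpleGraph V) (A : Set V) :
    G.IsConvexSet (G.convexHullSet A) := by
  intro u hu v hv p hp w hw S hS
  exact hS.1 u (hu S hS) v (hv S hS) p hp w hw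

theorem subset_convexHullSet (G : SimpleGraph V) (A : Set V) : A ⊆ G.convexHullSet A :=
  fun _ ha _ hS => hS.2 ha

theorem IsMVSet.induce {P S : Set V} (hP : G.IsMVSet P) (hS : G.IsConvexSet S) :
    (G.induce S).IsMVSet (Subtype.val ⁻¹' P) := by
  rintro ⟨u, hu⟩ huP ⟨v, hv⟩ hvP huv
  obtain ⟨p, hp, hint⟩ := hP u huP v hvP (fun h => huv (Subtype.ext h))
  have hpS := hS u hu v hv p hp
  set q := p.induce S hpS
  have hmap : q.map (Embedding.induce S).toHom = p := Walk.map_induce p hpS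
  have hlen : q.length = p.length :=
    (Walk.length_map _ q).symm.trans (congrArg Walk.length hmap)
  have hsupp : q.support.map Subtype.val = p.support :=
    (Walk.support_map _ q).symm.trans (congrArg Walk.support hmap)
  refine ⟨q, le_antisymm ?_ (dist_le q), fun w hw hwP => hint w ?_ hwP⟩
  · obtain ⟨r, hr⟩ := q.reachable.exists_walk_length_eq_dist
    rw [hlen, hp, ← hr, ← Walk.length_map (Embedding.induce S).toHom r]
    exact dist_le _
  · rw [← hsupp, ← List.map_tail, ← List.map_dropLast]
    exact List.mem_map_of_mem hw

theorem bddAbove_ncard_isMVSet [Finite V] (G : SimpleGraph V) :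
    BddAbove {n | ∃ P : Set V, G.IsMVSet P ∧ P.ncard = n} := by
  refine ⟨Nat.card V, ?_⟩
  rintro _ ⟨P, -, rfl⟩
  exact Set.ncard_le_card P

theorem IsMVSet.ncard_le [Fintype V] {P : Set V} (hP : G.IsMVSet P) :
    P.ncard ≤ G.mutualVisibilityNumber :=
  le_csSup G.bddAbove_ncard_isMVSet ⟨P, hP, rfl⟩

theorem exists_isMVSet_ncard_eq [Fintype V] (G : SimpleGraph V) :
    ∃ P : Set V, G.IsMVSet P ∧ P.ncard = G.mutualVisibilityNumber :=
  Nat.sSup_mem (s := {n | ∃ P : Set V, G.IsMVSet P ∧ P.ncard = n})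
    ⟨0, ∅, fun _ hu => hu.elim, Set.ncard_empty V⟩ G.bddAbove_ncard_isMVSet

end SimpleGraph

theorem mu_le_sum_mu_convexHull {V : Type*} [Fintype V] (G : SimpleGraph V)
    (k : ℕ) (Vs : Fin k → Set V) (hcov : (⋃ i, Vs i) = Set.univ) :
    G.mutualVisibilityNumber ≤
      ∑ i, (G.induce (G.convexHullSet (Vs i))).mutualVisibilityNumber := by
  obtain ⟨P, hP, hcard⟩ := G.exists_isMVSet_ncard_eq
  have hcover : P ⊆ ⋃ i, P ∩ G.convexHullSet (Vs i) := by
    intro x hx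
    obtain ⟨i, hi⟩ := Set.mem_iUnion.1 (hcov ▸ Set.mem_univ x)
    exact Set.mem_iUnion.2 ⟨i, hx, G.subset_convexHullSet _ hi⟩
  calc G.mutualVisibilityNumber = P.ncard := hcard.symm
    _ ≤ (⋃ i, P ∩ G.convexHullSet (Vs i)).ncard := Set.ncard_le_ncard hcover
    _ ≤ ∑ i, (P ∩ G.convexHullSet (Vs i)).ncard := Set.ncard_iUnion_le_of_fintype _
    _ ≤ ∑ i, (G.induce (G.convexHullSet (Vs i))).mutualVisibilityNumber := by
      refine Finset.sum_le_sum fun i _ => ?_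
      rw [Set.inter_comm, ← Subtype.image_preimage_coe,
        Set.ncard_image_of_injective _ Subtype.val_injective]
      exact (hP.induce (G.isConvexSet_convexHullSet _)).ncard_le
end

section
/- For every n ≥ 3, the mutual-visibility number of the cycle graph C_n on n vertices equals 3. -/
open SimpleGraph

attribute [local instance] Classical.propDecidable

namespace SimpleGraph

variable {V : Type*} {G : SimpleGraph V} {P : Set V} {u v : V}

theorem Walk.mem_tail_dropLast_support {p : G.Walk u v} {w : V} (hw : w ∈ p.support)
    (hu : w ≠ u) (hv : w ≠ v) : w ∈ p.support.tail.dropLast := by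
  have htail : w ∈ p.support.tail := by
    rw [← p.cons_tail_support] at hw
    exact (List.mem_cons.1 hw).resolve_left hu
  cases p with
  | nil => simp at htail
  | cons h p =>
    rw [Walk.support_cons, List.tail_cons] at htail ⊢
    rw [← List.dropLast_append_getLast p.support_ne_nil, List.mem_append] at htail
    refine htail.resolve_right fun h ↦ hv ?_
    rwa [Walk.getLast_support, List.mem_singleton] at h

theorem Walk.IsPath.ne_of_mem_tail_dropLast_support {p : G.Walk u v} (hp : p.IsPath) {w : V}
    (hw : w ∈ p.support.tail.dropLast) : w ≠ u ∧ w ≠ v := by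
  have hnd := hp.support_nodup
  cases p with
  | nil => simp at hw
  | cons h p =>
    rw [Walk.support_cons, List.tail_cons] at hw
    rw [Walk.support_cons, List.nodup_cons] at hnd
    refine ⟨fun e ↦ hnd.1 (e ▸ List.mem_of_mem_dropLast hw), fun e ↦ ?_⟩
    have hnd' := hnd.2
    rw [← List.dropLast_append_getLast p.support_ne_nil, List.nodup_append] at hnd'
    exact hnd'.2.2 w hw w (by simp [e]) rfl

theorem mutuallyVisible_iff :
    G.MutuallyVisible P u v ↔
      ∃ p : G.Walk u v, p.length = G.dist u v ∧ ∀ w ∈ p.support, w ∈ P → w = u ∨ w = v := by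
  refine exists_congr fun p ↦ and_congr_right fun hp ↦ ⟨fun h w hw hP ↦ ?_, fun h w hw hP ↦ ?_⟩
  · by_contra! hne
    exact h w (Walk.mem_tail_dropLast_support hw hne.1 hne.2) hP
  · have hne := (p.isPath_of_length_eq_dist hp).ne_of_mem_tail_dropLast_support hw
    exact (h w (List.mem_of_mem_tail (List.mem_of_mem_dropLast hw)) hP).elim hne.1 hne.2

theorem MutuallyVisible.symm (h : G.MutuallyVisible P u v) : G.MutuallyVisible P v u := by
  obtain ⟨p, hp, hP⟩ := mutuallyVisible_iff.1 h
  refine mutuallyVisible_iff.2 ⟨p.reverse, by rw [p.length_reverse, hp, dist_comm], ?_⟩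
  intro w hw hwP
  rw [Walk.support_reverse, List.mem_reverse] at hw
  exact (hP w hw hwP).symm

theorem isMVSet_triple {a b c : V} (hab : G.MutuallyVisible {a, b, c} a b)
    (hbc : G.MutuallyVisible {a, b, c} b c) (hca : G.MutuallyVisible {a, b, c} c a) :
    G.IsMVSet {a, b, c} := by
  rintro u (rfl | rfl | rfl) v (rfl | rfl | rfl) hne
  all_goals first
    | exact absurd rfl hne
    | assumption
    | exact MutuallyVisible.symm ‹_›

theorem cycleGraph_adj_iff_val {n : ℕ} (hn : 2 ≤ n) {u v : Fin n} :
    (cycleGraph n).Adj u v ↔ u.val + 1 = v.val ∨ v.val + 1 = u.val ∨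
      u.val + 1 = v.val + n ∨ v.val + 1 = u.val + n := by
  rw [cycleGraph_adj']
  have hu := u.isLt
  have hv := v.isLt
  rcases lt_trichotomy u v with h | rfl | h
  · rw [Fin.coe_sub_iff_lt.2 h, Fin.sub_val_of_le h.le]
    rw [Fin.lt_def] at h
    omega
  · have : NeZero n := ⟨by omega⟩
    rw [sub_self, Fin.val_zero]
    omega
  · rw [Fin.coe_sub_iff_lt.2 h, Fin.sub_val_of_le h.le]
    rw [Fin.lt_def] at h
    omega

theorem cycleGraph_le_length {n : ℕ} (hn : 2 ≤ n) {u v : Fin n} (p : (cycleGraph n).Walk u v) :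
    (v.val ≤ u.val + p.length ∧ u.val ≤ v.val + p.length) ∨
      u.val + n ≤ v.val + p.length ∨ v.val + n ≤ u.val + p.length := by
  induction p with
  | nil => simp
  | @cons u w v h p ih =>
    rw [cycleGraph_adj_iff_val hn] at h
    rw [Walk.length_cons]
    have hu := u.isLt
    have hv := v.isLt
    have hw := w.isLt
    omega

/-- Walk along the cycle from the vertex `m` to the vertex `m + k`, both read modulo `n`. -/
theorem exists_cycleGraph_walk {n : ℕ} (hn : 2 ≤ n) (m k : ℕ) {u v : Fin n}
    (hu : u.val = m % n) (hv : v.val = (m + k) % n) :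
    ∃ p : (cycleGraph n).Walk u v, p.length = k ∧
      ∀ w ∈ p.support, ∃ j ≤ k, w.val = (m + j) % n := by
  induction k generalizing m u with
  | zero =>
    obtain rfl : u = v := Fin.ext (by simpa [hu] using hv.symm)
    exact ⟨.nil, rfl, fun w hw ↦ ⟨0, le_rfl, by simp_all⟩⟩
  | succ k ih =>
    have hlt : (m + 1) % n < n := Nat.mod_lt _ (by omega)
    obtain ⟨p, hp, hs⟩ := ih (m + 1) (u := ⟨(m + 1) % n, hlt⟩) rfl (by rw [hv]; congr 1; omega)
    have hadj : (cycleGraph n).Adj u ⟨(m + 1) % n, hlt⟩ := by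
      rw [cycleGraph_adj_iff_val hn, hu]
      dsimp only
      have := Nat.mod_lt m (show 0 < n by omega)
      rw [Nat.add_mod, Nat.mod_eq_of_lt (show 1 < n by omega)]
      rcases Nat.lt_or_ge (m % n + 1) n with h | h
      · rw [Nat.mod_eq_of_lt h]; omega
      · rw [show m % n + 1 = n by omega, Nat.mod_self]; omega
    refine ⟨.cons hadj p, by rw [Walk.length_cons, hp], fun w hw ↦ ?_⟩
    rw [Walk.support_cons, List.mem_cons] at hw
    rcases hw with rfl | hw
    · exact ⟨0, by omega, hu⟩
    · obtain ⟨j, hj, hwj⟩ := hs w hw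
      exact ⟨j + 1, by omega, by rw [hwj]; congr 1; omega⟩

theorem cycleGraph_mutuallyVisible {n : ℕ} (hn : 2 ≤ n) {P : Set (Fin n)} {u v : Fin n} {k : ℕ}
    (hk : 2 * k ≤ n) (hv : v.val = (u.val + k) % n)
    (hP : ∀ w ∈ P, ∀ j ≤ k, w.val = (u.val + j) % n → w = u ∨ w = v) :
    (cycleGraph n).MutuallyVisible P u v := by
  obtain ⟨p, hp, hs⟩ :=
    exists_cycleGraph_walk hn u.val k (Nat.mod_eq_of_lt u.isLt).symm hv
  refine mutuallyVisible_iff.2 ⟨p, le_antisymm ?_ (dist_le p), fun w hw hwP ↦ ?_⟩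
  · obtain ⟨q, hq⟩ := p.reachable.exists_walk_length_eq_dist
    have hlen := cycleGraph_le_length hn q
    rw [hp, ← hq]
    have hu := u.isLt
    rcases Nat.lt_or_ge (u.val + k) n with h | h
    · rw [Nat.mod_eq_of_lt h] at hv
      omega
    · rw [Nat.mod_eq_sub_mod h, Nat.mod_eq_of_lt (by omega)] at hv
      omega
  · obtain ⟨j, hj, hwj⟩ := hs w hw
    exact hP w hwP j hj hwj

theorem exists_isMVSet_cycleGraph_ncard_eq_three {n : ℕ} (hn : 3 ≤ n) :
    ∃ P : Set (Fin n), (cycleGraph n).IsMVSet P ∧ P.ncard = 3 := by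
  refine ⟨{⟨0, by omega⟩, ⟨1, by omega⟩, ⟨(n + 1) / 2, by omega⟩}, isMVSet_triple ?_ ?_ ?_, ?_⟩
  · refine cycleGraph_mutuallyVisible (k := 1) (by omega) (by omega) ?_ ?_
    · exact (Nat.mod_eq_of_lt (by dsimp only; omega)).symm
    · intro w _ j hj hw
      rw [Nat.mod_eq_of_lt (by dsimp only; omega)] at hw
      simp only [Fin.ext_iff]
      dsimp only at hw
      omega
  · refine cycleGraph_mutuallyVisible (k := (n + 1) / 2 - 1) (by omega) (by omega) ?_ ?_
    · dsimp only
      rw [Nat.mod_eq_of_lt (by omega)]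
      omega
    · intro w hP j hj hw
      rw [Nat.mod_eq_of_lt (by dsimp only; omega)] at hw
      simp only [Set.mem_insert_iff, Set.mem_singleton_iff, Fin.ext_iff] at hP ⊢
      dsimp only at hw
      omega
  · refine cycleGraph_mutuallyVisible (k := n - (n + 1) / 2) (by omega) (by omega) ?_ ?_
    · dsimp only
      rw [show (n + 1) / 2 + (n - (n + 1) / 2) = n by omega, Nat.mod_self]
    · intro w hP j hj hw
      simp only [Set.mem_insert_iff, Set.mem_singleton_iff, Fin.ext_iff] at hP ⊢
      dsimp only at hw
      rcases Nat.lt_or_ge ((n + 1) / 2 + j) n with h | h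
      · rw [Nat.mod_eq_of_lt h] at hw
        omega
      · rw [show (n + 1) / 2 + j = n by omega, Nat.mod_self] at hw
        omega
  · rw [Set.ncard_eq_three]
    refine ⟨_, _, _, ?_, ?_, ?_, rfl⟩ <;> rw [Ne, Fin.ext_iff] <;> dsimp only <;> omega

/-- A walk into an arc of the cycle enters it through one of the two bounding vertices. -/
theorem cycleGraph_mem_support_of_lt {n : ℕ} {a b c d : Fin n} (hab : a < b) (hbc : b < c)
    (hcd : c < d) (p : (cycleGraph n).Walk a c) : b ∈ p.support ∨ d ∈ p.support := by
  obtain ⟨e, he, hfst, hsnd⟩ := p.reverse.exists_boundary_dart (Set.Ioo b d) ⟨hbc, hcd⟩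
    (fun h ↦ lt_asymm hab h.1)
  have hmem : e.snd ∈ p.support := by
    simpa using p.reverse.dart_snd_mem_support_of_mem_darts he
  have hadj := e.adj
  rw [cycleGraph_adj_iff_val (by omega)] at hadj
  simp only [Set.mem_Ioo, Fin.lt_def] at hfst hsnd
  have : e.snd = b ∨ e.snd = d := by
    rw [Fin.ext_iff, Fin.ext_iff]
    omega
  rcases this with h | h
  · exact .inl (h ▸ hmem)
  · exact .inr (h ▸ hmem)

theorem IsMVSet.ncard_le_three_of_cycleGraph {n : ℕ} {P : Set (Fin n)}
    (hP : (cycleGraph n).IsMVSet P) : P.ncard ≤ 3 := by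
  by_contra! hcard
  rw [Set.ncard_eq_toFinset_card'] at hcard
  obtain ⟨s, hsP, hs⟩ := Finset.exists_subset_card_eq (Nat.succ_le_of_lt hcard)
  set f := s.orderEmbOfFin hs
  have hf (i) : f i ∈ P := Set.mem_toFinset.1 (hsP (s.orderEmbOfFin_mem hs i))
  have h01 : f 0 < f 1 := f.strictMono (by decide)
  have h12 : f 1 < f 2 := f.strictMono (by decide)
  have h23 : f 2 < f 3 := f.strictMono (by decide)
  obtain ⟨p, -, hp⟩ :=
    mutuallyVisible_iff.1 (hP _ (hf 0) _ (hf 2) (h01.trans h12).ne)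
  rcases cycleGraph_mem_support_of_lt h01 h12 h23 p with h | h
  · exact (hp _ h (hf 1)).elim h01.ne' h12.ne
  · exact (hp _ h (hf 3)).elim (h01.trans (h12.trans h23)).ne' h23.ne'

end SimpleGraph

theorem mu_cycleGraph (n : ℕ) (hn : 3 ≤ n) :
    (cycleGraph n).mutualVisibilityNumber = 3 := by
  refine IsGreatest.csSup_eq ⟨exists_isMVSet_cycleGraph_ncard_eq_three hn, ?_⟩
  rintro _ ⟨P, hP, rfl⟩
  exact hP.ncard_le_three_of_cycleGraph
end

section
/- Let G=(V,E) be a finite simple connected block graph and let X be the set of its articulation vertices. Then V ∖ X is a mutual-visibility set of G and μ(G) = |V ∖ X|. -/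
open SimpleGraph

attribute [local instance] Classical.propDecidable

/-- `u` and `v` are joined by a walk of `G` that avoids the vertex `x`. -/
def SimpleGraph.ReachableAvoiding {V : Type*} (G : SimpleGraph V) (x u v : V) : Prop :=
  ∃ p : G.Walk u v, x ∉ p.support

theorem SimpleGraph.ReachableAvoiding.refl {V : Type*} {G : SimpleGraph V} {x u : V}
    (h : x ≠ u) : G.ReachableAvoiding x u u :=
  ⟨Walk.nil, by simpa using h⟩

theorem SimpleGraph.ReachableAvoiding.symm {V : Type*} {G : SimpleGraph V} {x u v : V}
    (h : G.ReachableAvoiding x u v) : G.ReachableAvoiding x v u := by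
  obtain ⟨p, hp⟩ := h
  exact ⟨p.reverse, by simpa using hp⟩

theorem SimpleGraph.ReachableAvoiding.trans {V : Type*} {G : SimpleGraph V} {x u v w : V}
    (h₁ : G.ReachableAvoiding x u v) (h₂ : G.ReachableAvoiding x v w) :
    G.ReachableAvoiding x u w := by
  obtain ⟨p, hp⟩ := h₁
  obtain ⟨q, hq⟩ := h₂
  exact ⟨p.append q, by simp [Walk.mem_support_append_iff, hp, hq]⟩

theorem SimpleGraph.reachable_induce_compl_singleton_iff {V : Type*} {G : SimpleGraph V} {x : V}
    (a b : ({x}ᶜ : Set V)) :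
    (G.induce {x}ᶜ).Reachable a b ↔ G.ReachableAvoiding x a b := by
  constructor
  · rintro ⟨p⟩
    refine ⟨p.map (Embedding.induce _).toHom, ?_⟩
    intro hx
    obtain ⟨y, -, hy⟩ := List.mem_map.1 ((Walk.support_map _ p) ▸ hx)
    exact y.2 hy
  · rintro ⟨p, hp⟩
    exact ⟨p.induce {x}ᶜ (fun y hy hyx => hp (hyx ▸ hy))⟩

theorem SimpleGraph.Connected.isArticulation_iff {V : Type*} [Finite V] {G : SimpleGraph V}
    (hG : G.Connected) (x : V) :
    G.IsArticulation x ↔ ∃ a b, a ≠ x ∧ b ≠ x ∧ ¬ G.ReachableAvoiding x a b := by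
  have hcard : Nat.card G.ConnectedComponent = 1 := by
    have := hG.preconnected.subsingleton_connectedComponent
    have := hG.nonempty.map G.connectedComponentMk
    exact Nat.card_eq_one_iff_unique.2 ⟨inferInstance, this⟩
  rw [IsArticulation, hcard, Finite.one_lt_card_iff_nontrivial]
  constructor
  · rintro ⟨c, d, hcd⟩
    obtain ⟨a, rfl⟩ := c.exists_rep
    obtain ⟨b, rfl⟩ := d.exists_rep
    refine ⟨a, b, a.2, b.2, fun h => hcd ?_⟩
    exact ConnectedComponent.sound ((reachable_induce_compl_singleton_iff a b).2 h)
  · rintro ⟨a, b, ha, hb, h⟩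
    refine ⟨(G.induce {x}ᶜ).connectedComponentMk ⟨a, ha⟩,
      (G.induce {x}ᶜ).connectedComponentMk ⟨b, hb⟩, fun hab => h ?_⟩
    exact (reachable_induce_compl_singleton_iff _ _).1 (ConnectedComponent.exact hab)

theorem SimpleGraph.Walk.IsPath.mem_tail_dropLast_support_iff {V : Type*} {G : SimpleGraph V}
    {u v w : V} {p : G.Walk u v} (hp : p.IsPath) :
    w ∈ p.support.tail.dropLast ↔ w ∈ p.support ∧ w ≠ u ∧ w ≠ v := by
  have hnd := hp.support_nodup
  cases p with
  | nil => simp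
  | cons h q =>
    rw [Walk.support_cons, List.tail_cons]
    rw [Walk.support_cons, List.nodup_cons] at hnd
    have hq := List.dropLast_append_getLast q.support_ne_nil
    rw [Walk.getLast_support] at hq
    have hmem : ∀ y, y ∈ q.support ↔ y ∈ q.support.dropLast ∨ y = v := fun y => by
      conv_lhs => rw [← hq]
      rw [List.mem_append, List.mem_singleton]
    have hnd' := hnd.2
    rw [← hq, List.nodup_append] at hnd'
    have hv : v ∉ q.support.dropLast := fun hv => hnd'.2.2 v hv v (by simp) rfl
    have hu := hnd.1
    rw [List.mem_cons, hmem]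
    constructor
    · intro hw
      exact ⟨Or.inr (Or.inl hw), fun e => hu ((hmem u).2 (Or.inl (e ▸ hw))), fun e => hv (e ▸ hw)⟩
    · rintro ⟨h1 | h1 | h1, h2, h3⟩
      · exact absurd h1 h2
      · exact h1
      · exact absurd h1 h3

theorem SimpleGraph.induce_connected_of_walks {V : Type*} {G : SimpleGraph V} {s : Set V} {u : V}
    (hu : u ∈ s) (h : ∀ v ∈ s, ∃ p : G.Walk v u, ∀ w ∈ p.support, w ∈ s) :
    (G.induce s).Connected := by
  have := Nonempty.intro (⟨u, hu⟩ : s)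
  refine connected_iff_exists_forall_reachable _ |>.2 ⟨⟨u, hu⟩, fun ⟨v, hv⟩ => ?_⟩
  obtain ⟨p, hp⟩ := h v hv
  exact Reachable.symm ⟨p.induce s hp⟩

/-- In a block graph, two nonadjacent neighbours of `w` are separated by `w`. -/
theorem SimpleGraph.IsBlockGraph.adj_of_reachableAvoiding {V : Type*} [Finite V]
    {G : SimpleGraph V} (hG : G.IsBlockGraph) {a b w : V} (ha : G.Adj w a) (hb : G.Adj w b)
    (hab : a ≠ b) (h : G.ReachableAvoiding w a b) : G.Adj a b := by
  obtain ⟨p, hp⟩ := h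
  obtain ⟨q, hq, hwq⟩ : ∃ q : G.Walk a b, q.IsPath ∧ w ∉ q.support :=
    ⟨p.bypass, p.bypass_isPath, fun hw => hp (p.support_bypass_subset_support hw)⟩
  let S : Set V := insert w {y | y ∈ q.support}
  have hqS : ∀ y ∈ q.support, y ∈ S := fun y hy => Or.inr hy
  have hwS : w ∈ S := Or.inl rfl
  have haS : a ∈ S := hqS a q.start_mem_support
  have hbS : b ∈ S := hqS b q.end_mem_support
  have hcard : 3 ≤ S.ncard :=
    (Set.two_lt_ncard (Set.toFinite S)).2 ⟨w, hwS, a, haS, b, hbS, ha.ne, hb.ne, hab⟩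
  refine hG S hcard ?_ (fun x hx => ?_) a haS b hbS hab
  · refine induce_connected_of_walks hwS ?_
    rintro v (rfl | hv)
    · exact ⟨Walk.nil, by simp [S]⟩
    · refine ⟨(q.takeUntil v hv).reverse.concat ha.symm, fun y hy => ?_⟩
      simp only [Walk.support_concat, Walk.support_reverse,
        List.mem_append, List.mem_reverse, List.mem_singleton] at hy
      rcases hy with hy | rfl
      · exact hqS y (q.support_takeUntil_subset_support hv hy)
      · exact hwS
  · rcases hx with rfl | hxq
    · have : S \ {x} = {y | y ∈ q.support} := by
        ext y
        simp only [S, Set.mem_sdiff, Set.mem_insert_iff, Set.mem_ofPred_eq, Set.mem_singleton_iff]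
        constructor
        · rintro ⟨h1 | h1, h2⟩
          · exact absurd h1 h2
          · exact h1
        · intro hy
          exact ⟨Or.inr hy, fun e => hwq (e ▸ hy)⟩
      rw [this]
      exact q.connected_induce_support
    · have hxw : w ≠ x := fun e => hwq (e ▸ hxq)
      refine induce_connected_of_walks (u := w) ⟨hwS, hxw⟩ ?_
      rintro v ⟨rfl | hv, hvx⟩
      · exact ⟨Walk.nil, by simpa [S] using hxw⟩
      · replace hvx : v ≠ x := hvx
        obtain ⟨q₁, q₂, rfl⟩ := Walk.mem_support_iff_exists_append.1 hv
        have hx' : x ∉ q₁.support ∨ x ∉ q₂.support := by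
          by_contra! hcon
          exact hq.ne_of_mem_support_of_append hvx.symm hcon.1 hcon.2 rfl
        have hsub₁ : ∀ y ∈ q₁.support, y ∈ S := fun y hy =>
          hqS y (Walk.mem_support_append_iff _ _ |>.2 (Or.inl hy))
        have hsub₂ : ∀ y ∈ q₂.support, y ∈ S := fun y hy =>
          hqS y (Walk.mem_support_append_iff _ _ |>.2 (Or.inr hy))
        rcases hx' with hx' | hx'
        · refine ⟨q₁.reverse.concat ha.symm, fun y hy => ?_⟩
          simp only [Walk.support_concat, Walk.support_reverse,
            List.mem_append, List.mem_reverse, List.mem_singleton] at hy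
          rcases hy with hy | rfl
          · exact ⟨hsub₁ y hy, fun e => hx' (e ▸ hy)⟩
          · exact ⟨hwS, hxw⟩
        · refine ⟨q₂.concat hb.symm, fun y hy => ?_⟩
          simp only [Walk.support_concat,
            List.mem_append, List.mem_singleton] at hy
          rcases hy with hy | rfl
          · exact ⟨hsub₂ y hy, fun e => hx' (e ▸ hy)⟩
          · exact ⟨hwS, hxw⟩

/-- Internal vertices of shortest paths in a block graph are articulation vertices. -/
theorem SimpleGraph.IsBlockGraph.isArticulation_of_mem_support {V : Type*} [Finite V]
    {G : SimpleGraph V} (hG : G.IsBlockGraph) (hconn : G.Connected) {u v w : V} {p : G.Walk u v}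
    (hp : p.length = G.dist u v) (hw : w ∈ p.support) (hwu : w ≠ u) (hwv : w ≠ v) :
    G.IsArticulation w := by
  obtain ⟨q, r, rfl⟩ := Walk.mem_support_iff_exists_append.1 hw
  rw [Walk.length_append, ← Walk.length_reverse] at hp
  cases hq : q.reverse with
  | nil => exact absurd rfl hwu
  | @cons _ a _ ha q' =>
    cases r with
    | nil => exact absurd rfl hwv
    | @cons _ b _ hb r' =>
      rw [hq, Walk.length_cons, Walk.length_cons] at hp
      have h1 := dist_le q'
      have h2 := dist_le r'
      have h3 := hconn.dist_triangle (u := u) (v := a) (w := v)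
      have h4 := hconn.dist_triangle (u := a) (v := b) (w := v)
      rw [dist_comm] at h1
      refine (hconn.isArticulation_iff w).2 ⟨a, b, ha.ne', hb.ne', fun h => ?_⟩
      have hab : a ≠ b := by
        rintro rfl
        rw [dist_self] at h4
        omega
      have h5 := dist_eq_one_iff_adj.2 (hG.adj_of_reachableAvoiding ha hb hab h)
      omega

/-- The non-articulation vertices of a connected block graph form a mutual-visibility set. -/
theorem SimpleGraph.IsBlockGraph.isMVSet_setOf_not_isArticulation {V : Type*} [Finite V]
    {G : SimpleGraph V} (hG : G.IsBlockGraph) (hconn : G.Connected) :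
    G.IsMVSet {v : V | ¬ G.IsArticulation v} := by
  intro u _ v _ _
  obtain ⟨p, hp, hlen⟩ := hconn.exists_path_of_dist u v
  refine ⟨p, hlen, fun w hw hwn => hwn ?_⟩
  obtain ⟨hw, hwu, hwv⟩ := hp.mem_tail_dropLast_support_iff.1 hw
  exact hG.isArticulation_of_mem_support hconn hlen hw hwu hwv

theorem SimpleGraph.IsMVSet.reachableAvoiding {V : Type*} {G : SimpleGraph V} {P : Set V}
    (hP : G.IsMVSet P) {x p q : V} (hx : x ∈ P) (hp : p ∈ P) (hq : q ∈ P) (hpx : x ≠ p)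
    (hqx : x ≠ q) : G.ReachableAvoiding x p q := by
  by_cases hpq : p = q
  · subst hpq
    exact .refl hpx
  · obtain ⟨w, hlen, hw⟩ := hP p hp q hq hpq
    refine ⟨w, fun hxw => hw x ?_ hx⟩
    exact (w.isPath_of_length_eq_dist hlen).mem_tail_dropLast_support_iff.2 ⟨hxw, hpx, hqx⟩

/-- A vertex `w` separated from `x` by `z` is farther from `x` than `z` and lies on the same side
of `x` as `z`. -/
theorem SimpleGraph.Connected.dist_lt_of_not_reachableAvoiding {V : Type*} {G : SimpleGraph V}
    (hconn : G.Connected) {x z w : V} (hzx : z ≠ x) (hwz : w ≠ z)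
    (h : ¬ G.ReachableAvoiding z x w) :
    G.dist x z < G.dist x w ∧ G.ReachableAvoiding x z w := by
  obtain ⟨p, hp, hlen⟩ := hconn.exists_path_of_dist x w
  have hz : z ∈ p.support := by
    by_contra hz
    exact h ⟨p, hz⟩
  obtain ⟨q, r, rfl⟩ := Walk.mem_support_iff_exists_append.1 hz
  rw [Walk.length_append] at hlen
  have h1 := dist_le q
  have h2 : 0 < r.length := (hconn.pos_dist_of_ne hwz.symm).trans_le (dist_le r)
  refine ⟨by omega, r, fun hx => ?_⟩
  exact hp.ne_of_mem_support_of_append hzx.symm q.start_mem_support hx rfl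

/-- An articulation vertex `x` of a mutual-visibility set `P` separates `P` from some
non-articulation vertex. -/
theorem SimpleGraph.IsMVSet.exists_not_isArticulation {V : Type*} [Finite V] {G : SimpleGraph V}
    (hconn : G.Connected) {P : Set V} (hP : G.IsMVSet P) {x : V} (hx : x ∈ P)
    (hxa : G.IsArticulation x) :
    ∃ z, ¬ G.IsArticulation z ∧ z ≠ x ∧ ∀ p ∈ P, ¬ G.ReachableAvoiding x p z := by
  have havoid : ∀ {p z}, G.ReachableAvoiding x p z → x ≠ p := by
    rintro p z ⟨w, hw⟩ rfl
    exact hw w.start_mem_support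
  have hne : ∃ c, c ≠ x ∧ ∀ p ∈ P, ¬ G.ReachableAvoiding x p c := by
    obtain ⟨a, b, ha, hb, hab⟩ := (hconn.isArticulation_iff x).1 hxa
    by_contra! hcon
    obtain ⟨p, hp, hpa⟩ := hcon a ha
    obtain ⟨q, hq, hqb⟩ := hcon b hb
    exact hab ((hpa.symm.trans (hP.reachableAvoiding hx hp hq (havoid hpa) (havoid hqb))).trans hqb)
  obtain ⟨z, ⟨hzx, hz⟩, hmax⟩ := Set.exists_max_image
    {c | c ≠ x ∧ ∀ p ∈ P, ¬ G.ReachableAvoiding x p c} (G.dist x) (Set.toFinite _) hne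
  refine ⟨z, fun hza => ?_, hzx, hz⟩
  obtain ⟨a, b, ha, hb, hab⟩ := (hconn.isArticulation_iff z).1 hza
  have key : ∀ w, w ≠ z → G.ReachableAvoiding z x w := by
    intro w hwz
    by_contra hw
    obtain ⟨hlt, hr⟩ := hconn.dist_lt_of_not_reachableAvoiding hzx hwz hw
    refine hlt.not_ge (hmax w ⟨?_, fun p hp hpw => hz p hp (hpw.trans hr.symm)⟩)
    rintro rfl
    simp at hlt
  exact hab ((key a ha).symm.trans (key b hb))

theorem SimpleGraph.IsMVSet.ncard_le_s12 {V : Type*} [Finite V] {G : SimpleGraph V}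
    (hconn : G.Connected) {P : Set V} (hP : G.IsMVSet P) :
    P.ncard ≤ {v : V | ¬ G.IsArticulation v}.ncard := by
  choose! f hf hfx hfP using
    fun x (hx : x ∈ P ∧ G.IsArticulation x) => hP.exists_not_isArticulation hconn hx.1 hx.2
  have hfmem : ∀ x, x ∈ P → G.IsArticulation x → f x ∉ P := fun x hx hxa hfx' =>
    hfP x ⟨hx, hxa⟩ _ hfx' (.refl (hfx x ⟨hx, hxa⟩).symm)
  refine Set.ncard_le_ncard_of_injOn (fun x => if G.IsArticulation x then f x else x)
    (fun x hx => ?_) (fun x hx y hy hxy => ?_) (Set.toFinite _)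
  · by_cases hxa : G.IsArticulation x
    · simpa [hxa] using hf x ⟨hx, hxa⟩
    · simp [hxa]
  · by_cases hxa : G.IsArticulation x <;> by_cases hya : G.IsArticulation y <;>
      simp only [hxa, hya, if_true, if_false] at hxy
    · by_contra hne
      have h := (hconn.dist_lt_of_not_reachableAvoiding hne (hfx x ⟨hx, hxa⟩)
        (hfP x ⟨hx, hxa⟩ y hy)).2
      exact hfP y ⟨hy, hya⟩ x hx (hxy ▸ h)
    · exact absurd (hxy ▸ hy) (hfmem x hx hxa)
    · exact absurd (hxy ▸ hx) (hfmem y hy hya)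
    · exact hxy

theorem mu_blockGraph {V : Type*} [Fintype V] (G : SimpleGraph V)
    (hconn : G.Connected) (hblock : G.IsBlockGraph) :
    G.IsMVSet {v : V | ¬ G.IsArticulation v} ∧
      G.mutualVisibilityNumber = {v : V | ¬ G.IsArticulation v}.ncard := by
  have hmv := hblock.isMVSet_setOf_not_isArticulation hconn
  refine ⟨hmv, IsGreatest.csSup_eq ⟨⟨_, hmv, rfl⟩, ?_⟩⟩
  rintro n ⟨P, hP, rfl⟩
  exact hP.ncard_le_s12 hconn
end

section
/- Let T=(V,E) be a finite tree with at least 2 vertices and let L be the set of its leaves. Then L is a mutual-visibility set of T and μ(T) = |L|. -/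
open SimpleGraph

attribute [local instance] Classical.propDecidable

namespace SimpleGraph

variable {V : Type*} {G : SimpleGraph V}

lemma Walk.eq_or_eq_or_mem_dropLast_tail_support {u v x : V} (p : G.Walk u v)
    (hx : x ∈ p.support) : x = u ∨ x = v ∨ x ∈ p.support.tail.dropLast := by
  cases p with
  | nil => simp_all
  | cons h q =>
    rw [Walk.support_cons, List.mem_cons] at hx
    refine hx.imp_right fun hx => ?_
    rw [← List.dropLast_append_getLast q.support_ne_nil, Walk.getLast_support] at hx
    simp only [List.mem_append, List.mem_singleton] at hx
    exact hx.symm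

lemma Walk.exists_getVert_of_mem_dropLast_tail_support {u v x : V} (p : G.Walk u v)
    (hx : x ∈ p.support.tail.dropLast) : ∃ i, i + 1 < p.length ∧ p.getVert (i + 1) = x := by
  obtain ⟨i, hi, rfl⟩ := List.getElem_of_mem hx
  have hi' : i + 1 < p.length := by simp at hi; omega
  refine ⟨i, hi', ?_⟩
  rw [p.getVert_eq_support_getElem hi'.le]
  simp

/-- An internal vertex of a path has degree different from one. -/
lemma Walk.IsPath.degree_ne_one_of_mem_dropLast_tail_support {u v x : V} {p : G.Walk u v}
    (hp : p.IsPath) (hx : x ∈ p.support.tail.dropLast) [Fintype (G.neighborSet x)] :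
    G.degree x ≠ 1 := by
  obtain ⟨i, hi, rfl⟩ := p.exists_getVert_of_mem_dropLast_tail_support hx
  rw [Ne, degree_eq_one_iff_existsUnique_adj]
  intro h
  have heq := h.unique (p.adj_getVert_succ (i := i) (by omega)).symm (p.adj_getVert_succ hi)
  have := hp.getVert_injOn (by rw [Set.mem_ofPred]; omega) (by rw [Set.mem_ofPred]; omega) heq
  omega

/-- Every walk from `u` to `v` passes through `x`. -/
def Separates (G : SimpleGraph V) (x u v : V) : Prop :=
  ∀ p : G.Walk u v, x ∈ p.support

/-- In a tree, following a path through `x` as far as possible from its start leads to a leaf. -/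
lemma IsTree.exists_separates_degree_eq_one [Finite V] [G.LocallyFinite] (hG : G.IsTree)
    {u x : V} (hux : u ≠ x) : ∃ l, G.degree l = 1 ∧ G.Separates x u l := by
  obtain ⟨l, hl, hmax⟩ := Set.exists_max_image {l | G.Separates x u l} (G.dist u)
    (Set.toFinite _) ⟨x, fun p => p.end_mem_support⟩
  refine ⟨l, ?_, hl⟩
  have hul : u ≠ l := by
    rintro rfl
    exact hux (List.mem_singleton.1 (hl .nil)).symm
  obtain ⟨p, hp, -⟩ := hG.connected.exists_path_of_dist u l
  have hnil : ¬ p.Nil := fun h => hul h.eq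
  rw [degree_eq_one_iff_existsUnique_adj]
  refine ⟨p.penultimate, (p.adj_penultimate hnil).symm, fun y hy => ?_⟩
  by_contra hne
  have hy' : y ∉ p.support := fun h => hne (hG.isAcyclic.eq_penultimate_of_adj_end hp hy h)
  have hunique : ∀ q : G.Walk u y, q.IsPath → q = p.concat hy := fun q hq =>
    (hG.existsUnique_path u y).unique hq (hp.concat hy' hy)
  have hsep : G.Separates x u y := fun q => by
    refine q.support_bypass_subset_support ?_
    rw [hunique _ q.bypass_isPath]
    exact p.support_subset_support_concat hy (hl p)
  obtain ⟨q, hq, hlen⟩ := hG.connected.exists_path_of_dist u y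
  rw [hunique q hq, Walk.length_concat] at hlen
  have := hmax y hsep
  have := dist_le p
  omega

lemma IsMVSet.separates {P : Set V} (hP : G.IsMVSet P) {u x y l : V} (hu : u ∈ P) (hx : x ∈ P)
    (hy : y ∈ P) (hux : u ≠ x) (hyx : y ≠ x) (h : G.Separates x u l) : G.Separates x y l := by
  intro q
  rcases eq_or_ne u y with rfl | huy
  · exact h q
  obtain ⟨p, -, hp⟩ := hP u hu y hy huy
  rcases (Walk.mem_support_append_iff p q).1 (h (p.append q)) with hxp | hxq
  · rcases p.eq_or_eq_or_mem_dropLast_tail_support hxp with rfl | rfl | hmem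
    · exact absurd rfl hux
    · exact absurd rfl hyx
    · exact absurd hx (hp x hmem)
  · exact hxq

lemma Separates.dist_lt (hG : G.Connected) {x y l : V} (hyx : x ≠ y) (h : G.Separates x y l) :
    G.dist x l < G.dist y l := by
  obtain ⟨p, hp⟩ := hG.exists_walk_length_eq_dist y l
  rw [← hp]
  exact (dist_le _).trans_lt (p.length_dropUntil_lt_length (h p) hyx)

/-- A mutual-visibility set of a nontrivial tree has at most as many elements as there are
leaves. -/
lemma IsMVSet.ncard_le_of_isTree [Finite V] [Nontrivial V] [G.LocallyFinite] (hG : G.IsTree)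
    {P : Set V} (hP : G.IsMVSet P) : P.ncard ≤ {v : V | G.degree v = 1}.ncard := by
  rcases P.subsingleton_or_nontrivial with hsub | hnt
  · obtain ⟨v, -, -, hv, -⟩ := hG.exists_ne_and_degree_eq_one
    exact ((Set.ncard_le_one_iff_subsingleton).2 hsub).trans
      ((Set.ncard_pos (Set.toFinite _)).2 ⟨v, hv⟩)
  · have hex : ∀ x ∈ P, ∃ l, G.degree l = 1 ∧ ∀ y ∈ P, y ≠ x → G.Separates x y l := by
      intro x hx
      obtain ⟨u, hu, hux⟩ := hnt.exists_ne x
      obtain ⟨l, hl, hsep⟩ := hG.exists_separates_degree_eq_one hux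
      exact ⟨l, hl, fun y hy hyx => hP.separates hu hx hy hux hyx hsep⟩
    choose! f hleaf hsep using hex
    refine Set.ncard_le_ncard_of_injOn f hleaf (fun x hx y hy hxy => ?_) (Set.toFinite _)
    by_contra hne
    have hlt := (hsep x hx y hy (Ne.symm hne)).dist_lt hG.connected hne
    have hgt := (hsep y hy x hx hne).dist_lt hG.connected (Ne.symm hne)
    rw [hxy] at hlt
    exact hlt.asymm hgt

/-- In a connected graph, the vertices of degree one form a mutual-visibility set. -/
lemma Connected.isMVSet_setOf_degree_eq_one [G.LocallyFinite] (hG : G.Connected) :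
    G.IsMVSet {v : V | G.degree v = 1} := by
  intro u _ v _ _
  obtain ⟨p, hp, hlen⟩ := hG.exists_path_of_dist u v
  exact ⟨p, hlen, fun w hw => hp.degree_ne_one_of_mem_dropLast_tail_support hw⟩

end SimpleGraph

theorem mu_tree {V : Type*} [Fintype V] (G : SimpleGraph V) [DecidableRel G.Adj]
    (htree : G.IsTree) (hcard : 2 ≤ Fintype.card V) :
    G.IsMVSet {v : V | G.degree v = 1} ∧
      G.mutualVisibilityNumber = {v : V | G.degree v = 1}.ncard := by
  have : Nontrivial V := Fintype.one_lt_card_iff_nontrivial.1 hcard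
  have hL : G.IsMVSet {v : V | G.degree v = 1} := htree.connected.isMVSet_setOf_degree_eq_one
  refine ⟨hL, IsGreatest.csSup_eq ⟨⟨_, hL, rfl⟩, ?_⟩⟩
  rintro _ ⟨P, hP, rfl⟩
  exact hP.ncard_le_of_isTree htree
end

section
/- Let Γ_{m,n} = P_m □ P_n be the grid graph obtained as the Cartesian (box) product of the path graphs P_m and P_n, with m > 3 and n > 3. Then μ(Γ_{m,n}) = 2·min(m,n). -/
open SimpleGraph

attribute [local instance] Classical.propDecidable

/-- The `ℓ¹` distance between two vertices of the grid. -/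
def gridDist {m n : ℕ} (p q : Fin m × Fin n) : ℕ :=
  ((p.1 : ℕ) - q.1) + ((q.1 : ℕ) - p.1) + (((p.2 : ℕ) - q.2) + ((q.2 : ℕ) - p.2))

lemma grid_adj_iff {m n : ℕ} (p q : Fin m × Fin n) :
    ((pathGraph m) □ (pathGraph n)).Adj p q ↔ gridDist p q = 1 := by
  simp only [boxProd_adj, pathGraph_adj, gridDist, Fin.ext_iff]
  omega

lemma gridDist_eq_zero_iff {m n : ℕ} (p q : Fin m × Fin n) : gridDist p q = 0 ↔ p = q := by
  simp only [gridDist, Prod.ext_iff, Fin.ext_iff]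
  omega

lemma gridDist_triangle {m n : ℕ} (p q r : Fin m × Fin n) :
    gridDist p r ≤ gridDist p q + gridDist q r := by
  simp only [gridDist]
  omega

lemma gridDist_le_length {m n : ℕ} {p q : Fin m × Fin n}
    (w : ((pathGraph m) □ (pathGraph n)).Walk p q) : gridDist p q ≤ w.length := by
  induction w with
  | nil => simp [gridDist]
  | @cons a b c h w ih =>
    have h1 := (grid_adj_iff a b).1 h
    have h2 := gridDist_triangle a b c
    rw [Walk.length_cons]
    omega

/-- If every vertex of `S` not next to `q` has a neighbour in `S` closer to `q`, then from each
vertex of `S` there is a geodesic to `q` staying in `S` until it reaches `q`. -/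
lemma exists_walk_of_descent {m n : ℕ} {S : Set (Fin m × Fin n)} {q : Fin m × Fin n}
    (h : ∀ r ∈ S, 2 ≤ gridDist r q →
      ∃ t ∈ S, gridDist r t = 1 ∧ gridDist t q + 1 = gridDist r q) :
    ∀ (k : ℕ), ∀ r ∈ S, gridDist r q = k + 1 →
      ∃ w : ((pathGraph m) □ (pathGraph n)).Walk r q,
        w.length = k + 1 ∧ ∀ v ∈ w.support.dropLast, v ∈ S := by
  intro k
  induction k with
  | zero =>
    intro r hr hd
    exact ⟨Walk.cons ((grid_adj_iff r q).2 hd) Walk.nil, by simp, by simpa using hr⟩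
  | succ k ih =>
    intro r hr hd
    obtain ⟨t, ht, h1, h2⟩ := h r hr (by omega)
    obtain ⟨w, hw, hS⟩ := ih t ht (by omega)
    refine ⟨Walk.cons ((grid_adj_iff r t).2 h1) w, by simp [hw], ?_⟩
    intro v hv
    rw [Walk.support_cons, List.dropLast_cons_of_ne_nil w.support_ne_nil, List.mem_cons] at hv
    rcases hv with rfl | hv
    · exact hr
    · exact hS v hv

lemma exists_closer {m n : ℕ} {r q : Fin m × Fin n} (S : ℤ → ℤ → Prop)
    (h : ((r.1 : ℤ) < q.1 ∧ S (r.1 + 1) r.2) ∨ ((q.1 : ℤ) < r.1 ∧ S (r.1 - 1) r.2) ∨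
      ((r.2 : ℤ) < q.2 ∧ S r.1 (r.2 + 1)) ∨ ((q.2 : ℤ) < r.2 ∧ S r.1 (r.2 - 1))) :
    ∃ t : Fin m × Fin n, S t.1 t.2 ∧ gridDist r t = 1 ∧ gridDist t q + 1 = gridDist r q := by
  obtain ⟨⟨x, hx⟩, ⟨y, hy⟩⟩ := r
  obtain ⟨⟨a, ha⟩, ⟨b, hb⟩⟩ := q
  simp only [gridDist] at *
  rcases h with ⟨h, hS⟩ | ⟨h, hS⟩ | ⟨h, hS⟩ | ⟨h, hS⟩
  · exact ⟨(⟨x + 1, by omega⟩, ⟨y, hy⟩), by simpa using hS, by simp, by simp only []; omega⟩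
  · refine ⟨(⟨x - 1, by omega⟩, ⟨y, hy⟩), ?_, by simp only []; omega, by simp only []; omega⟩
    simpa [Nat.cast_sub (show 1 ≤ x by omega)] using hS
  · exact ⟨(⟨x, hx⟩, ⟨y + 1, by omega⟩), by simpa using hS, by simp, by simp only []; omega⟩
  · refine ⟨(⟨x, hx⟩, ⟨y - 1, by omega⟩), ?_, by simp only []; omega, by simp only []; omega⟩
    simpa [Nat.cast_sub (show 1 ≤ y by omega)] using hS

lemma grid_dist {m n : ℕ} (p q : Fin m × Fin n) :
    ((pathGraph m) □ (pathGraph n)).dist p q = gridDist p q := by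
  have key : ∃ w : ((pathGraph m) □ (pathGraph n)).Walk p q, w.length = gridDist p q := by
    rcases hk : gridDist p q with _ | k
    · obtain rfl := (gridDist_eq_zero_iff p q).1 hk
      exact ⟨Walk.nil, rfl⟩
    · obtain ⟨w, hw, -⟩ := exists_walk_of_descent (S := Set.univ) (q := q) (by
        intro r _ hr
        obtain ⟨t, -, ht⟩ := exists_closer (r := r) (q := q) (fun _ _ => True) (by
          simp only [gridDist] at hr
          simp only [and_true]
          omega)
        exact ⟨t, trivial, ht⟩) k p trivial hk
      exact ⟨w, hw⟩
  obtain ⟨w, hw⟩ := key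
  obtain ⟨w', hw'⟩ := w.reachable.exists_walk_length_eq_dist
  have h1 := dist_le w
  have h2 := gridDist_le_length w'
  omega

lemma grid_mutuallyVisible {m n : ℕ} {P : Set (Fin m × Fin n)} {p q : Fin m × Fin n}
    (hpq : p ≠ q) (S : ℤ → ℤ → Prop) (hP : ∀ r ∈ P, ¬ S r.1 r.2)
    (h : ∀ r : Fin m × Fin n, (r = p ∨ S r.1 r.2) → 2 ≤ gridDist r q →
      ((r.1 : ℤ) < q.1 ∧ S (r.1 + 1) r.2) ∨ ((q.1 : ℤ) < r.1 ∧ S (r.1 - 1) r.2) ∨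
      ((r.2 : ℤ) < q.2 ∧ S r.1 (r.2 + 1)) ∨ ((q.2 : ℤ) < r.2 ∧ S r.1 (r.2 - 1))) :
    ((pathGraph m) □ (pathGraph n)).MutuallyVisible P p q := by
  unfold SimpleGraph.MutuallyVisible
  rw [grid_dist]
  rcases hk : gridDist p q with _ | _ | k
  · exact absurd ((gridDist_eq_zero_iff p q).1 hk) hpq
  · exact ⟨Walk.cons ((grid_adj_iff p q).2 hk) Walk.nil, by simp, by simp⟩
  · obtain ⟨t, ht, h1, h2⟩ := exists_closer S (h p (Or.inl rfl) (by omega))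
    obtain ⟨w, hw, hS⟩ := exists_walk_of_descent (S := {r | S r.1 r.2}) (q := q)
      (fun r hr hd => exists_closer S (h r (Or.inr hr) hd)) k t ht (by omega)
    refine ⟨Walk.cons ((grid_adj_iff p t).2 h1) w, by simp [hw], ?_⟩
    intro v hv hvP
    rw [Walk.support_cons, List.tail_cons] at hv
    exact hP v hvP (hS v hv)

lemma SimpleGraph.Walk.mem_tail_dropLast_support_s14 {V : Type*} {G : SimpleGraph V} {u v x : V}
    (w : G.Walk u v) (hx : x ∈ w.support) (hu : x ≠ u) (hv : x ≠ v) :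
    x ∈ w.support.tail.dropLast := by
  cases w with
  | nil => simp_all
  | cons h w =>
    rw [Walk.support_cons, List.mem_cons] at hx
    rw [Walk.support_cons, List.tail_cons]
    have hx := hx.resolve_left hu
    rw [← List.dropLast_append_getLast w.support_ne_nil, List.mem_append] at hx
    simpa [hv] using hx

/-- A point `b` between `a` and `c` on a line of the grid is the only one at its position on
geodesics from `a` to `c`. -/
lemma eq_of_gridDist_le {m n : ℕ} {a b c x : Fin m × Fin n}
    (h : (a.1 = b.1 ∧ a.1 = c.1 ∧ a.2 < b.2 ∧ b.2 < c.2) ∨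
      (a.2 = b.2 ∧ a.2 = c.2 ∧ a.1 < b.1 ∧ b.1 < c.1))
    (h1 : gridDist a x ≤ gridDist a b) (h2 : gridDist x c ≤ gridDist a c - gridDist a b) :
    x = b := by
  obtain ⟨⟨a, _⟩, ⟨a', _⟩⟩ := a
  obtain ⟨⟨b, _⟩, ⟨b', _⟩⟩ := b
  obtain ⟨⟨c, _⟩, ⟨c', _⟩⟩ := c
  obtain ⟨⟨x, _⟩, ⟨y, _⟩⟩ := x
  simp only [gridDist, Fin.mk.injEq, Fin.mk_lt_mk, Prod.mk.injEq] at *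
  rcases h with ⟨rfl, rfl, h, h'⟩ | ⟨rfl, rfl, h, h'⟩
  · have e1 : b' - a' + (c' - b') = c' - a' := by omega
    simp only [Nat.sub_self, Nat.sub_eq_zero_of_le h.le, Nat.sub_eq_zero_of_le (h.trans h').le]
      at h1 h2
    constructor <;> omega
  · have e1 : b - a + (c - b) = c - a := by omega
    simp only [Nat.sub_self, Nat.sub_eq_zero_of_le h.le, Nat.sub_eq_zero_of_le (h.trans h').le]
      at h1 h2
    constructor <;> omega

/-- No point of a mutual-visibility set is strictly between two others on a line of the grid. -/
lemma false_of_between {m n : ℕ} {P : Set (Fin m × Fin n)}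
    (hP : ((pathGraph m) □ (pathGraph n)).IsMVSet P) {a b c : Fin m × Fin n}
    (ha : a ∈ P) (hb : b ∈ P) (hc : c ∈ P)
    (h : (a.1 = b.1 ∧ a.1 = c.1 ∧ a.2 < b.2 ∧ b.2 < c.2) ∨
      (a.2 = b.2 ∧ a.2 = c.2 ∧ a.1 < b.1 ∧ b.1 < c.1)) : False := by
  have hac : a ≠ c := by
    rintro rfl
    rcases h with h | h <;> exact (h.2.2.1.trans h.2.2.2).false
  obtain ⟨w, hw, hvis⟩ := hP a ha c hc hac
  rw [grid_dist] at hw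
  have h1 := gridDist_le_length (w.take (gridDist a b))
  have h2 := gridDist_le_length (w.drop (gridDist a b))
  rw [Walk.take_length] at h1
  rw [Walk.drop_length, hw] at h2
  have hmem := w.getVert_mem_support (gridDist a b)
  have hbx : w.getVert (gridDist a b) = b :=
    eq_of_gridDist_le h (h1.trans (min_le_left _ _)) h2
  rw [hbx] at hmem
  refine hvis b (w.mem_tail_dropLast_support_s14 hmem ?_ ?_) hb
  · rintro rfl
    rcases h with h | h <;> exact h.2.2.1.false
  · rintro rfl
    rcases h with h | h <;> exact h.2.2.2.false

lemma ncard_le_of_isMVSet {m n : ℕ} {P : Set (Fin m × Fin n)}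
    (hP : ((pathGraph m) □ (pathGraph n)).IsMVSet P) : P.ncard ≤ 2 * min m n := by
  have key : ∀ {k : ℕ} (f : Fin m × Fin n → Fin k),
      (∀ a ∈ P, ∀ b ∈ P, ∀ c ∈ P, f a = f b → f a = f c → a ≠ b → a ≠ c → b ≠ c → False) →
      P.ncard ≤ 2 * k := by
    intro k f hf
    rw [Set.ncard_eq_toFinset_card']
    have := Finset.card_le_mul_card_image_of_maps_to (f := f) (s := P.toFinset)
      (t := Finset.univ) (fun _ _ => Finset.mem_univ _) 2 (by
        intro i _
        by_contra! hc
        obtain ⟨a, b, c, ha, hb, hc, hab, hac, hbc⟩ := Finset.two_lt_card_iff.1 hc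
        simp only [Finset.mem_filter, Set.mem_toFinset] at ha hb hc
        exact hf a ha.1 b hb.1 c hc.1 (ha.2.trans hb.2.symm) (ha.2.trans hc.2.symm) hab hac hbc)
    simpa using this
  have h1 := key Prod.fst (by
    rintro ⟨x, a⟩ ha ⟨_, b⟩ hb ⟨_, c⟩ hc rfl rfl hab hac hbc
    have hbtw : ∀ a b c, (x, a) ∈ P → (x, b) ∈ P → (x, c) ∈ P → ¬ (a < b ∧ b < c) :=
      fun a b c ha hb hc h => false_of_between hP ha hb hc (Or.inl ⟨rfl, rfl, h⟩)
    grind)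
  have h2 := key Prod.snd (by
    rintro ⟨a, y⟩ ha ⟨b, _⟩ hb ⟨c, _⟩ hc rfl rfl hab hac hbc
    have hbtw : ∀ a b c, (a, y) ∈ P → (b, y) ∈ P → (c, y) ∈ P → ¬ (a < b ∧ b < c) :=
      fun a b c ha hb hc h => false_of_between hP ha hb hc (Or.inr ⟨rfl, rfl, h⟩)
    grind)
  omega

/-- The lattice points on the boundary of the tilted rectangle
`s ≤ x + y ≤ t`, `-a ≤ x - y ≤ a`. -/
def tiltedBoundary (m n : ℕ) (s t a : ℤ) : Set (Fin m × Fin n) :=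
  {p | s ≤ (p.1 : ℤ) + p.2 ∧ (p.1 : ℤ) + p.2 ≤ t ∧ -a ≤ (p.1 : ℤ) - p.2 ∧ (p.1 : ℤ) - p.2 ≤ a ∧
    ((p.1 : ℤ) + p.2 = s ∨ (p.1 : ℤ) + p.2 = t ∨ (p.1 : ℤ) - p.2 = -a ∨ (p.1 : ℤ) - p.2 = a)}

lemma exists_step_of_add_le {x y x' y' s : ℤ} (hd : 2 ≤ |x - x'| + |y - y'|) (h : x + y ≤ s)
    (h' : x' + y' = s) :
    (x < x' ∧ x + 1 + y < s) ∨ (x' < x ∧ x - 1 + y < s) ∨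
      (y < y' ∧ x + (y + 1) < s) ∨ (y' < y ∧ x + (y - 1) < s) := by
  rcases lt_or_ge x' x with hx | hx
  · exact Or.inr (Or.inl ⟨hx, by omega⟩)
  rcases lt_or_ge y' y with hy | hy
  · exact Or.inr (Or.inr (Or.inr ⟨hy, by omega⟩))
  rw [abs_of_nonpos (by omega), abs_of_nonpos (by omega)] at hd
  rcases hx.lt_or_eq with hx | hx
  · exact Or.inl ⟨hx, by omega⟩
  · exact Or.inr (Or.inr (Or.inl ⟨by omega, by omega⟩))

lemma exists_step_of_interior {x y x' y' s t a : ℤ} (hst : s + 3 ≤ t) (ha : 2 ≤ a)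
    (hd : 2 ≤ |x - x'| + |y - y'|)
    (r1 : s ≤ x + y) (r2 : x + y ≤ t) (r3 : -a ≤ x - y) (r4 : x - y ≤ a)
    (q1 : s ≤ x' + y') (q2 : x' + y' ≤ t) (q3 : -a ≤ x' - y') (q4 : x' - y' ≤ a)
    (_e1 : x + y = s → s < x' + y') (_e2 : x + y = t → x' + y' < t)
    (_e3 : x - y = -a → -a < x' - y') (_e4 : x - y = a → x' - y' < a) :
    (x < x' ∧ s < x + 1 + y ∧ x + 1 + y < t ∧ -a < x + 1 - y ∧ x + 1 - y < a) ∨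
      (x' < x ∧ s < x - 1 + y ∧ x - 1 + y < t ∧ -a < x - 1 - y ∧ x - 1 - y < a) ∨
      (y < y' ∧ s < x + (y + 1) ∧ x + (y + 1) < t ∧ -a < x - (y + 1) ∧ x - (y + 1) < a) ∨
      (y' < y ∧ s < x + (y - 1) ∧ x + (y - 1) < t ∧ -a < x - (y - 1) ∧ x - (y - 1) < a) := by
  rcases le_total x x' with hx | hx <;> rcases le_total y y' with hy | hy
  · rw [abs_of_nonpos (by omega), abs_of_nonpos (by omega)] at hd
    by_cases h : x < x' ∧ x + 1 - y < a ∧ -a < x + 1 - y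
    · exact Or.inl ⟨by omega, by omega, by omega, by omega, by omega⟩
    · exact Or.inr (Or.inr (Or.inl ⟨by omega, by omega, by omega, by omega, by omega⟩))
  · rw [abs_of_nonpos (by omega), abs_of_nonneg (by omega)] at hd
    by_cases h : x < x' ∧ x + 1 + y < t ∧ s < x + 1 + y
    · exact Or.inl ⟨by omega, by omega, by omega, by omega, by omega⟩
    · exact Or.inr (Or.inr (Or.inr ⟨by omega, by omega, by omega, by omega, by omega⟩))
  · rw [abs_of_nonneg (by omega), abs_of_nonpos (by omega)] at hd
    by_cases h : x' < x ∧ x - 1 + y < t ∧ s < x - 1 + y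
    · exact Or.inr (Or.inl ⟨by omega, by omega, by omega, by omega, by omega⟩)
    · exact Or.inr (Or.inr (Or.inl ⟨by omega, by omega, by omega, by omega, by omega⟩))
  · rw [abs_of_nonneg (by omega), abs_of_nonneg (by omega)] at hd
    by_cases h : x' < x ∧ x - 1 - y < a ∧ -a < x - 1 - y
    · exact Or.inr (Or.inl ⟨by omega, by omega, by omega, by omega, by omega⟩)
    · exact Or.inr (Or.inr (Or.inr ⟨by omega, by omega, by omega, by omega, by omega⟩))

lemma two_le_abs_add_abs {m n : ℕ} {r q : Fin m × Fin n} (h : 2 ≤ gridDist r q) :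
    2 ≤ |(r.1 : ℤ) - q.1| + |(r.2 : ℤ) - q.2| := by
  have h1 := abs_cases ((r.1 : ℤ) - q.1)
  have h2 := abs_cases ((r.2 : ℤ) - q.2)
  simp only [gridDist] at h
  omega

lemma tiltedBoundary_isMVSet (m n : ℕ) {s t a : ℤ} (hst : s + 3 ≤ t) (ha : 2 ≤ a) :
    ((pathGraph m) □ (pathGraph n)).IsMVSet (tiltedBoundary m n s t a) := by
  intro p ⟨p1, p2, p3, p4, p5⟩ q ⟨q1, q2, q3, q4, q5⟩ hpq
  by_cases c1 : (p.1 : ℤ) + p.2 = s ∧ (q.1 : ℤ) + q.2 = s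
  · refine grid_mutuallyVisible hpq (fun x y => x + y < s)
      (fun r ⟨h1, h2, h3, h4, h5⟩ => by clear p5 q5; omega) fun r hr hd => ?_
    have hr : (r.1 : ℤ) + r.2 ≤ s := by
      clear p5 q5
      rcases hr with rfl | hr <;> omega
    have hd := two_le_abs_add_abs hd
    have := exists_step_of_add_le (s := s) hd (by omega) (by omega)
    clear hd p5 q5
    omega
  by_cases c2 : (p.1 : ℤ) + p.2 = t ∧ (q.1 : ℤ) + q.2 = t
  · refine grid_mutuallyVisible hpq (fun x y => t < x + y)
      (fun r ⟨h1, h2, h3, h4, h5⟩ => by clear p5 q5; omega) fun r hr hd => ?_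
    have hr : t ≤ (r.1 : ℤ) + r.2 := by
      clear p5 q5
      rcases hr with rfl | hr <;> omega
    have hd := two_le_abs_add_abs hd
    rw [← abs_neg ((r.1 : ℤ) - q.1), neg_sub'] at hd
    rw [← abs_neg ((r.2 : ℤ) - q.2), neg_sub'] at hd
    have := exists_step_of_add_le (s := -t) hd (by omega) (by omega)
    clear hd p5 q5
    omega
  by_cases c3 : (p.1 : ℤ) - p.2 = -a ∧ (q.1 : ℤ) - q.2 = -a
  · refine grid_mutuallyVisible hpq (fun x y => x - y < -a)
      (fun r ⟨h1, h2, h3, h4, h5⟩ => by clear p5 q5; omega) fun r hr hd => ?_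
    have hr : (r.1 : ℤ) - r.2 ≤ -a := by
      clear p5 q5
      rcases hr with rfl | hr <;> omega
    have hd := two_le_abs_add_abs hd
    rw [← abs_neg ((r.2 : ℤ) - q.2), neg_sub'] at hd
    have := exists_step_of_add_le (s := -a) hd (by omega) (by omega)
    clear hd p5 q5
    omega
  by_cases c4 : (p.1 : ℤ) - p.2 = a ∧ (q.1 : ℤ) - q.2 = a
  · refine grid_mutuallyVisible hpq (fun x y => a < x - y)
      (fun r ⟨h1, h2, h3, h4, h5⟩ => by clear p5 q5; omega) fun r hr hd => ?_
    have hr : a ≤ (r.1 : ℤ) - r.2 := by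
      clear p5 q5
      rcases hr with rfl | hr <;> omega
    have hd := two_le_abs_add_abs hd
    rw [← abs_neg ((r.1 : ℤ) - q.1), neg_sub'] at hd
    have := exists_step_of_add_le (s := -a) hd (by omega) (by omega)
    clear hd p5 q5
    omega
  refine grid_mutuallyVisible hpq
    (fun x y => s < x + y ∧ x + y < t ∧ -a < x - y ∧ x - y < a)
    (fun r ⟨h1, h2, h3, h4, h5⟩ => by clear p5 q5 c1 c2 c3 c4; omega) fun r hr hd => ?_
  have hd := two_le_abs_add_abs hd
  clear p5 q5
  rcases hr with rfl | ⟨h1, h2, h3, h4⟩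
  · apply exists_step_of_interior hst ha hd <;> omega
  · clear c1 c2 c3 c4
    apply exists_step_of_interior hst ha hd <;> omega

lemma two_mul_min_le_ncard_tiltedBoundary {m n : ℕ} {k : ℕ} (hm : k ≤ m) (hn : k ≤ n)
    (hk : 3 < k) :
    2 * k ≤ (tiltedBoundary m n ((k - 1) / 2) (k - 1 + k / 2) ((k + 1) / 2)).ncard := by
  let L : Fin k → Fin m × Fin n := fun i =>
    (⟨i, by omega⟩, ⟨max ((k - 1) / 2 - i) (i - (k + 1) / 2), by omega⟩)
  let R : Fin k → Fin m × Fin n := fun i =>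
    (⟨i, by omega⟩, ⟨min (i + (k + 1) / 2) (k - 1 + k / 2 - i), by omega⟩)
  have hinj : Function.Injective (Sum.elim L R) := by
    rintro (i | i) (j | j) h <;>
      simp only [Sum.elim_inl, Sum.elim_inr, L, R, Prod.mk.injEq, Fin.mk.injEq] at h
    · rw [Fin.ext h.1]
    · omega
    · omega
    · rw [Fin.ext h.1]
  have hsub : Set.range (Sum.elim L R) ⊆
      tiltedBoundary m n ((k - 1) / 2) (k - 1 + k / 2) ((k + 1) / 2) := by
    rintro _ ⟨i | i, rfl⟩ <;> simp only [Sum.elim_inl, Sum.elim_inr, L, R, tiltedBoundary,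
      Set.mem_ofPred_eq] <;> omega
  have h := Set.ncard_le_ncard hsub (Set.toFinite _)
  rw [← Set.image_univ, Set.ncard_image_of_injective _ hinj, Set.ncard_univ] at h
  simp only [Nat.card_eq_fintype_card, Fintype.card_sum, Fintype.card_fin] at h
  omega

theorem mu_grid (m n : ℕ) (hm : 3 < m) (hn : 3 < n) :
    ((pathGraph m) □ (pathGraph n)).mutualVisibilityNumber = 2 * min m n := by
  have hbdd : ∀ k ∈ {k | ∃ P : Set (Fin m × Fin n),
      ((pathGraph m) □ (pathGraph n)).IsMVSet P ∧ P.ncard = k}, k ≤ 2 * min m n := by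
    rintro _ ⟨P, hP, rfl⟩
    exact ncard_le_of_isMVSet hP
  have hmv := tiltedBoundary_isMVSet m n (s := ((min m n : ℕ) - 1) / 2)
    (t := (min m n : ℕ) - 1 + (min m n : ℕ) / 2) (a := ((min m n : ℕ) + 1) / 2)
    (by omega) (by omega)
  have hcard := two_mul_min_le_ncard_tiltedBoundary (min_le_left m n) (min_le_right m n) (by omega)
  exact le_antisymm (csSup_le' hbdd) (hcard.trans (le_csSup ⟨_, hbdd⟩ ⟨_, hmv, rfl⟩))
end

section
/- Let T_{m,n} = C_m □ C_n be the torus graph obtained as the Cartesian (box) product of the cycle graphs C_m and C_n, with m ≥ 3 and n ≥ 3. Then μ(T_{m,n}) ≤ 3·min(m,n). -/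
open SimpleGraph

attribute [local instance] Classical.propDecidable

namespace SimpleGraph

variable {V W : Type*} {G : SimpleGraph V} {H : SimpleGraph W}

theorem Walk.mem_internal_of_mem_support {u v w : V} (p : G.Walk u v) (hw : w ∈ p.support)
    (hu : w ≠ u) (hv : w ≠ v) : w ∈ p.support.tail.dropLast := by
  rw [← p.dropLast_support_concat, List.mem_append, List.mem_singleton] at hw
  have hw := hw.resolve_right hv
  rw [← List.tail_dropLast]
  cases h : p.support.dropLast with
  | nil => simp [h] at hw
  | cons a l =>
    have h' := p.cons_tail_support
    rw [← p.dropLast_support_concat, h] at h'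
    simp only [List.cons_append, List.cons.injEq] at h'
    rw [h, List.mem_cons] at hw
    exact hw.resolve_left (h'.1 ▸ hu)

theorem dist_boxProd (hG : G.Preconnected) (hH : H.Preconnected) (x y : V × W) :
    (G □ H).dist x y = G.dist x.1 y.1 + H.dist x.2 y.2 := by
  rw [dist, edist_boxProd, ENat.toNat_add] <;> first
    | rfl
    | exact edist_ne_top_iff_reachable.2 (hG _ _)
    | exact edist_ne_top_iff_reachable.2 (hH _ _)

theorem snd_eq_of_mem_shortest_boxProd_walk (hG : G.Connected) (hH : H.Connected) {x y z : V × W}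
    (hxy : x.2 = y.2) (p : (G □ H).Walk x y) (hp : p.length = (G □ H).dist x y)
    (hz : z ∈ p.support) : z.2 = x.2 := by
  have hlen := congrArg Walk.length (p.take_spec hz)
  rw [Walk.length_append] at hlen
  have h₁ := dist_le (p.takeUntil z hz)
  have h₂ := dist_le (p.dropUntil z hz)
  rw [dist_boxProd hG.preconnected hH.preconnected] at h₁ h₂ hp
  have htri := hG.dist_triangle (u := x.1) (v := z.1) (w := y.1)
  rw [← hxy, dist_self] at hp
  exact (hH.dist_eq_zero_iff.1 (by lia : H.dist x.2 z.2 = 0)).symm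

theorem dist_iso (φ : G ≃g H) (hG : G.Connected) (u v : V) :
    H.dist (φ u) (φ v) = G.dist u v := by
  apply le_antisymm
  · obtain ⟨p, hp⟩ := hG.exists_walk_length_eq_dist u v
    simpa [hp] using dist_le (p.map φ.toHom)
  · obtain ⟨p, hp⟩ := (φ.connected_iff.1 hG).exists_walk_length_eq_dist (φ u) (φ v)
    have h := dist_le (p.map φ.symm.toHom)
    rw [Walk.length_map, hp] at h
    simpa using h

theorem IsMVSet.image_iso {P : Set V} (hP : G.IsMVSet P) (φ : G ≃g H) (hG : G.Connected) :
    H.IsMVSet (φ '' P) := by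
  rintro _ ⟨u, hu, rfl⟩ _ ⟨v, hv, rfl⟩ huv
  obtain ⟨p, hp, hpP⟩ := hP u hu v hv (ne_of_apply_ne φ huv)
  refine ⟨p.map φ.toHom, ?_, fun w hw ↦ ?_⟩
  · rw [Walk.length_map, hp]
    exact (dist_iso φ hG u v).symm
  · rw [Walk.support_map, ← List.map_tail, ← List.map_dropLast] at hw
    obtain ⟨x, hx, rfl⟩ := List.mem_map.1 hw
    rintro ⟨y, hy, hyx⟩
    exact hpP x hx (φ.injective hyx ▸ hy)

theorem eq_or_eq_of_cycleGraph_adj {k : ℕ} {b d u v : Fin k} (h : (cycleGraph k).Adj u v)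
    (hu : b < u ∧ u < d) (hv : ¬(b < v ∧ v < d)) : v = b ∨ v = d := by
  rw [cycleGraph_adj'] at h
  have := d.isLt
  have := v.isLt
  simp only [Fin.lt_def, Fin.ext_iff] at *
  rcases h with h | h
  · rcases le_or_gt v.val u.val with hvu | hvu
    · rw [Fin.sub_val_of_le hvu] at h
      lia
    · rw [Fin.coe_sub_iff_lt.2 hvu] at h
      lia
  · rcases le_or_gt u.val v.val with hvu | hvu
    · rw [Fin.sub_val_of_le hvu] at h
      lia
    · rw [Fin.coe_sub_iff_lt.2 hvu] at h
      lia

theorem IsMVSet.not_four_in_cycle_fiber {k : ℕ} (hG : (cycleGraph k).Connected) (hH : H.Connected)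
    {P : Set (Fin k × W)} (hP : (cycleGraph k □ H).IsMVSet P) {y : W} {a b c d : Fin k}
    (hab : a < b) (hbc : b < c) (hcd : c < d) (ha : (a, y) ∈ P) (hb : (b, y) ∈ P)
    (hc : (c, y) ∈ P) (hd : (d, y) ∈ P) : False := by
  obtain ⟨p, hp, hpP⟩ := hP _ hc _ ha (by simp [(hab.trans hbc).ne'])
  obtain ⟨e, he, heS, heT⟩ := p.exists_boundary_dart {z | b < z.1 ∧ z.1 < d} ⟨hbc, hcd⟩
    (fun h ↦ h.1.not_gt hab)
  have hmem := p.dart_snd_mem_support_of_mem_darts he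
  have hsnd := snd_eq_of_mem_shortest_boxProd_walk hG hH (by rfl) p hp hmem
  have hadj : (cycleGraph k).Adj e.fst.1 e.snd.1 := by
    rcases boxProd_adj.1 e.adj with h | h
    · exact h.1
    · exact absurd heS (by simpa [h.2] using heT)
  rcases eq_or_eq_of_cycleGraph_adj hadj heS heT with h | h
  · have h' : e.snd = (b, y) := Prod.ext h hsnd
    rw [h'] at hmem
    exact hpP _ (p.mem_internal_of_mem_support hmem (by simp [hbc.ne]) (by simp [hab.ne'])) hb
  · have h' : e.snd = (d, y) := Prod.ext h hsnd
    rw [h'] at hmem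
    exact hpP _ (p.mem_internal_of_mem_support hmem (by simp [hcd.ne'])
      (by simp [(hab.trans (hbc.trans hcd)).ne'])) hd

theorem IsMVSet.ncard_le_of_cycleGraph_boxProd [Fintype W] {k : ℕ} (hG : (cycleGraph k).Connected)
    (hH : H.Connected) {P : Set (Fin k × W)} (hP : (cycleGraph k □ H).IsMVSet P) :
    P.ncard ≤ 3 * Fintype.card W := by
  rw [Set.ncard_eq_toFinset_card']
  refine Finset.card_le_mul_card_image_of_maps_to (f := Prod.snd) (fun _ _ ↦ Finset.mem_univ _) 3
    fun y _ ↦ ?_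
  by_contra! hcard
  set F := (P.toFinset.filter fun z ↦ z.2 = y).image Prod.fst with hF
  have hFcard : 4 ≤ F.card := by
    rw [hF, Finset.card_image_of_injOn]
    · exact hcard
    · intro x hx z hz hxz
      simp only [Finset.coe_filter, Set.mem_ofPred_eq] at hx hz
      exact Prod.ext hxz (hx.2.trans hz.2.symm)
  have hFP : ∀ x ∈ F, (x, y) ∈ P := by
    intro x hx
    obtain ⟨z, hz, rfl⟩ := Finset.mem_image.1 hx
    obtain ⟨hzP, rfl⟩ := Finset.mem_filter.1 hz
    exact Set.mem_toFinset.1 hzP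
  have hmem : ∀ i : Fin 4, (F.orderEmbOfCardLe hFcard i, y) ∈ P := fun i ↦
    hFP _ (F.orderEmbOfCardLe_mem hFcard i)
  have hlt : ∀ i j : Fin 4, i < j → F.orderEmbOfCardLe hFcard i < F.orderEmbOfCardLe hFcard j :=
    fun i j h ↦ (F.orderEmbOfCardLe hFcard).strictMono h
  exact hP.not_four_in_cycle_fiber hG hH (hlt 0 1 (by decide)) (hlt 1 2 (by decide))
    (hlt 2 3 (by decide)) (hmem 0) (hmem 1) (hmem 2) (hmem 3)

end SimpleGraph

theorem mu_torus_le (m n : ℕ) (hm : 3 ≤ m) (hn : 3 ≤ n) :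
    ((cycleGraph m) □ (cycleGraph n)).mutualVisibilityNumber ≤ 3 * min m n := by
  have : NeZero m := ⟨by lia⟩
  have : NeZero n := ⟨by lia⟩
  have hGm : (cycleGraph m).Connected := ⟨cycleGraph_preconnected⟩
  have hGn : (cycleGraph n).Connected := ⟨cycleGraph_preconnected⟩
  refine csSup_le ⟨0, ∅, by simp [IsMVSet], by simp⟩ ?_
  rintro _ ⟨P, hP, rfl⟩
  have h₁ := hP.ncard_le_of_cycleGraph_boxProd hGm hGn
  have h₂ := (hP.image_iso (boxProdComm _ _) (hGm.boxProd hGn)).ncard_le_of_cycleGraph_boxProd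
    hGn hGm
  rw [Set.ncard_image_of_injective _ (boxProdComm _ _).injective] at h₂
  simp only [Fintype.card_fin] at h₁ h₂
  lia
end

section
/- Let G be the complete bipartite graph K_{m,n} with m ≥ 3 and n ≥ 3. Then μ(G) = m + n − 2. -/
open SimpleGraph

attribute [local instance] Classical.propDecidable

namespace SimpleGraph

variable {V : Type*} {G : SimpleGraph V} {P : Set V} {u v w : V}

lemma Adj.mutuallyVisible (h : G.Adj u v) : G.MutuallyVisible P u v :=
  ⟨h.toWalk, by simp [dist_eq_one_iff_adj.mpr h], by simp⟩

lemma dist_eq_two_of_common_neighbor (hne : u ≠ v) (hadj : ¬ G.Adj u v)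
    (huw : G.Adj u w) (hwv : G.Adj w v) : G.dist u v = 2 := by
  let p : G.Walk u v := .cons huw hwv.toWalk
  have h2 : G.dist u v ≤ 2 := dist_le p
  have h0 : G.dist u v ≠ 0 := fun h ↦ hne ((Reachable.dist_eq_zero_iff ⟨p⟩).mp h)
  have h1 : G.dist u v ≠ 1 := fun h ↦ hadj (dist_eq_one_iff_adj.mp h)
  omega

lemma mutuallyVisible_of_common_neighbor (hne : u ≠ v) (hadj : ¬ G.Adj u v)
    (huw : G.Adj u w) (hwv : G.Adj w v) (hw : w ∉ P) : G.MutuallyVisible P u v :=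
  ⟨.cons huw hwv.toWalk, by simp [dist_eq_two_of_common_neighbor hne hadj huw hwv], by simpa⟩

lemma MutuallyVisible.exists_common_neighbor_notMem (h : G.MutuallyVisible P u v)
    (hdist : G.dist u v = 2) : ∃ w ∉ P, G.Adj u w ∧ G.Adj w v := by
  obtain ⟨p, hp, hP⟩ := h
  rw [hdist] at hp
  match p, hp, hP with
  | .cons (v := w) huw (.cons hwv .nil), _, hP => exact ⟨w, hP w (by simp), huw, hwv⟩

end SimpleGraph

section CompleteBipartite

variable {α β : Type*} {P : Set (α ⊕ β)}

lemma isMVSet_compl_pair_completeBipartiteGraph (a : α) (b : β) :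
    (completeBipartiteGraph α β).IsMVSet {Sum.inl a, Sum.inr b}ᶜ := by
  rintro (x | x) - (y | y) - hne
  · exact mutuallyVisible_of_common_neighbor (w := .inr b) hne (by simp) (by simp) (by simp)
      (by simp)
  · exact Adj.mutuallyVisible (by simp)
  · exact Adj.mutuallyVisible (by simp)
  · exact mutuallyVisible_of_common_neighbor (w := .inl a) hne (by simp) (by simp) (by simp)
      (by simp)

lemma SimpleGraph.IsMVSet.exists_inr_notMem (hP : (completeBipartiteGraph α β).IsMVSet P)
    [Nonempty β] {x y : α} (hx : Sum.inl x ∈ P) (hy : Sum.inl y ∈ P) (hne : x ≠ y) :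
    ∃ b, Sum.inr b ∉ P := by
  have hxy : (Sum.inl x : α ⊕ β) ≠ Sum.inl y := by simpa
  obtain ⟨b⟩ := ‹Nonempty β›
  obtain ⟨w | w, hw, hadj, -⟩ := (hP _ hx _ hy hxy).exists_common_neighbor_notMem
    (dist_eq_two_of_common_neighbor (w := .inr b) hxy (by simp) (by simp) (by simp))
  · simp at hadj
  · exact ⟨w, hw⟩

lemma SimpleGraph.IsMVSet.exists_inl_notMem (hP : (completeBipartiteGraph α β).IsMVSet P)
    [Nonempty α] {x y : β} (hx : Sum.inr x ∈ P) (hy : Sum.inr y ∈ P) (hne : x ≠ y) :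
    ∃ a, Sum.inl a ∉ P := by
  have hxy : (Sum.inr x : α ⊕ β) ≠ Sum.inr y := by simpa
  obtain ⟨a⟩ := ‹Nonempty α›
  obtain ⟨w | w, hw, hadj, -⟩ := (hP _ hx _ hy hxy).exists_common_neighbor_notMem
    (dist_eq_two_of_common_neighbor (w := .inl a) hxy (by simp) (by simp) (by simp))
  · exact ⟨w, hw⟩
  · simp at hadj

lemma exists_pair_ne_of_two_lt_card [Fintype α] (h : 2 < Fintype.card α) {Q : α → Prop}
    (hQ : ∀ x y, ¬ Q x → ¬ Q y → x = y) : ∃ x y, Q x ∧ Q y ∧ x ≠ y := by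
  obtain ⟨a, b, c, hab, hac, hbc⟩ := Fintype.two_lt_card_iff.mp h
  by_contra! hcon
  by_cases ha : Q a <;> by_cases hb : Q b <;> by_cases hc : Q c <;> grind

lemma SimpleGraph.IsMVSet.two_le_ncard_compl [Fintype α] [Fintype β]
    (hα : 2 < Fintype.card α) (hβ : 2 < Fintype.card β)
    (hP : (completeBipartiteGraph α β).IsMVSet P) : 2 ≤ Pᶜ.ncard := by
  have : Nonempty α := Fintype.card_pos_iff.mp (by omega)
  have : Nonempty β := Fintype.card_pos_iff.mp (by omega)
  by_contra! hlt
  have hsub : ∀ u v, u ∉ P → v ∉ P → u = v := fun u v hu hv ↦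
    (Set.ncard_le_one (Set.toFinite Pᶜ)).mp (by omega) u hu v hv
  obtain ⟨x, y, hx, hy, hxy⟩ := exists_pair_ne_of_two_lt_card hα (Q := fun a ↦ Sum.inl a ∈ P)
    fun x y hx hy ↦ Sum.inl_injective (hsub _ _ hx hy)
  obtain ⟨z, w, hz, hw, hzw⟩ := exists_pair_ne_of_two_lt_card hβ (Q := fun b ↦ Sum.inr b ∈ P)
    fun x y hx hy ↦ Sum.inr_injective (hsub _ _ hx hy)
  obtain ⟨b, hb⟩ := hP.exists_inr_notMem hx hy hxy
  obtain ⟨a, ha⟩ := hP.exists_inl_notMem hz hw hzw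
  exact Sum.inl_ne_inr (hsub _ _ ha hb)

end CompleteBipartite

theorem mu_completeBipartite (m n : ℕ) (hm : 3 ≤ m) (hn : 3 ≤ n) :
    (completeBipartiteGraph (Fin m) (Fin n)).mutualVisibilityNumber = m + n - 2 := by
  have hcard (P : Set (Fin m ⊕ Fin n)) : P.ncard + Pᶜ.ncard = m + n := by
    simpa using Set.ncard_add_ncard_compl P
  refine IsGreatest.csSup_eq ⟨⟨{Sum.inl ⟨0, by omega⟩, Sum.inr ⟨0, by omega⟩}ᶜ,
    isMVSet_compl_pair_completeBipartiteGraph _ _, ?_⟩, ?_⟩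
  · have h := hcard {Sum.inl ⟨0, by omega⟩, Sum.inr ⟨0, by omega⟩}
    rw [Set.ncard_pair Sum.inl_ne_inr] at h
    omega
  · rintro _ ⟨P, hP, rfl⟩
    have h := hP.two_le_ncard_compl (by simp; omega) (by simp; omega)
    have := hcard P
    omega
end
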